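/- For every finite projective plane Π of order q, C_7(Π) = (q^2 + q + 1)(q^2 + q)q^2(q - 1)^2(q - 3)(q - 5)(q^4 - 20q^3 + 148q^2 - 468q + 498) - A_7(Π); equivalently, C_7(Π) + A_7(Π) equals this polynomial in q. -/

import Mathlib

open scoped Classical

structure ProjPlane (q : ℕ) where
  Point : Type
  fintypePoint : Fintype Point
  L : Set (Set Point)
  unique_line : ∀ p₁ p₂ : Point, p₁ ≠ p₂ → ∃! ℓ, ℓ ∈ L ∧ p₁ ∈ ℓ ∧ p₂ ∈ ℓ
  unique_point : ∀ ℓ₁ ℓ₂, ℓ₁ ∈ L → ℓ₂ ∈ L → ℓ₁ ≠ ℓ₂ → ∃! p, p ∈ ℓ₁ ∧ p ∈ ℓ₂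
  nondegenerate : ∃ a b c d : Point, a ≠ b ∧ a ≠ c ∧ a ≠ d ∧ b ≠ c ∧ b ≠ d ∧ c ≠ d ∧
    ∀ ℓ ∈ L, ¬({a, b, c} ⊆ ℓ) ∧ ¬({a, b, d} ⊆ ℓ) ∧ ¬({a, c, d} ⊆ ℓ) ∧ ¬({b, c, d} ⊆ ℓ)
  line_card : ∀ ℓ ∈ L, ℓ.ncard = q + 1
  point_card : ∀ p : Point, {ℓ ∈ L | p ∈ ℓ}.ncard = q + 1

/-- A set of points is collinear if it is contained in a line. -/
noncomputable def ProjPlane.Collinear {q : ℕ} (Pl : ProjPlane q) (s : Set Pl.Point) : Prop :=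
  ∃ ℓ ∈ Pl.L, s ⊆ ℓ

/-- The number of ordered `n`-arcs of the plane. -/
noncomputable def ProjPlane.nArcs {q : ℕ} (Pl : ProjPlane q) (n : ℕ) : ℕ :=
  Nat.card {p : Fin n → Pl.Point // Function.Injective p ∧
    ∀ i j k : Fin n, i ≠ j → i ≠ k → j ≠ k → ¬ Pl.Collinear {p i, p j, p k}}

/-- Number of ordered strong realizations of the Fano plane. -/
noncomputable def ProjPlane.A7 {q : ℕ} (Pl : ProjPlane q) : ℕ :=
  Nat.card {p : ZMod 7 → Pl.Point // Function.Injective p ∧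
    ∃ σ : Equiv.Perm (ZMod 7), ∀ i j k : ZMod 7, i ≠ j → i ≠ k → j ≠ k →
      (Pl.Collinear {p (σ i), p (σ j), p (σ k)} ↔
        ∃ a : ZMod 7, ({i, j, k} : Set (ZMod 7)) = {a, a + 1, a + 3})}

/-- Number of ordered strong realizations of the Möbius–Kantor configuration. -/
noncomputable def ProjPlane.A8 {q : ℕ} (Pl : ProjPlane q) : ℕ :=
  Nat.card {p : ZMod 8 → Pl.Point // Function.Injective p ∧
    ∃ σ : Equiv.Perm (ZMod 8), ∀ i j k : ZMod 8, i ≠ j → i ≠ k → j ≠ k →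
      (Pl.Collinear {p (σ i), p (σ j), p (σ k)} ↔
        ∃ a : ZMod 8, ({i, j, k} : Set (ZMod 8)) = {a, a + 1, a + 3})}

namespace ProjPlane

variable {q : ℕ} {Pl : ProjPlane q}

noncomputable instance : Fintype Pl.Point := Pl.fintypePoint

theorem exists_line (a b : Pl.Point) : ∃ ℓ ∈ Pl.L, a ∈ ℓ ∧ b ∈ ℓ := by
  by_cases h : a = b
  · subst h
    have h : {ℓ ∈ Pl.L | a ∈ ℓ}.Nonempty := by
      apply Set.nonempty_of_ncard_ne_zero
      rw [Pl.point_card]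
      lia
    obtain ⟨ℓ, h₁, h₂⟩ := h
    exact ⟨ℓ, h₁, h₂, h₂⟩
  · obtain ⟨ℓ, ⟨h₁, h₂, h₃⟩, -⟩ := Pl.unique_line a b h
    exact ⟨ℓ, h₁, h₂, h₃⟩

/-- The line through two distinct points; some line through `a` if `a = b`. -/
noncomputable def line (a b : Pl.Point) : Set Pl.Point := (exists_line a b).choose

theorem line_mem (a b : Pl.Point) : line a b ∈ Pl.L := (exists_line a b).choose_spec.1

@[simp]
theorem left_mem_line (a b : Pl.Point) : a ∈ line a b := (exists_line a b).choose_spec.2.1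

@[simp]
theorem right_mem_line (a b : Pl.Point) : b ∈ line a b := (exists_line a b).choose_spec.2.2

theorem line_unique {a b : Pl.Point} (hab : a ≠ b) {ℓ m : Set Pl.Point} (hℓ : ℓ ∈ Pl.L)
    (hm : m ∈ Pl.L) (haℓ : a ∈ ℓ) (hbℓ : b ∈ ℓ) (ham : a ∈ m) (hbm : b ∈ m) : ℓ = m :=
  (Pl.unique_line a b hab).unique ⟨hℓ, haℓ, hbℓ⟩ ⟨hm, ham, hbm⟩

theorem eq_line {a b : Pl.Point} (hab : a ≠ b) {ℓ : Set Pl.Point} (hℓ : ℓ ∈ Pl.L)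
    (ha : a ∈ ℓ) (hb : b ∈ ℓ) : ℓ = line a b :=
  line_unique hab hℓ (line_mem a b) ha hb (by simp) (by simp)

theorem line_comm {a b : Pl.Point} (hab : a ≠ b) : line a b = line b a :=
  eq_line hab.symm (line_mem a b) (by simp) (by simp)

theorem point_unique {ℓ m : Set Pl.Point} (hℓ : ℓ ∈ Pl.L) (hm : m ∈ Pl.L) (h : ℓ ≠ m)
    {x y : Pl.Point} (hxℓ : x ∈ ℓ) (hxm : x ∈ m) (hyℓ : y ∈ ℓ) (hym : y ∈ m) : x = y :=
  (Pl.unique_point ℓ m hℓ hm h).unique ⟨hxℓ, hxm⟩ ⟨hyℓ, hym⟩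

theorem collinear_iff {a b c : Pl.Point} (h : b ≠ c) :
    Pl.Collinear {a, b, c} ↔ a ∈ line b c := by
  constructor
  · rintro ⟨ℓ, hℓ, hs⟩
    rw [← eq_line h hℓ (hs (by simp)) (hs (by simp))]
    exact hs (by simp)
  · intro ha
    refine ⟨_, line_mem b c, ?_⟩
    rintro x (rfl | rfl | rfl) <;> simp [ha]

theorem card_line {ℓ : Set Pl.Point} (hℓ : ℓ ∈ Pl.L) :
    ({x | x ∈ ℓ} : Finset Pl.Point).card = q + 1 := by
  rw [← Pl.line_card ℓ hℓ, Set.ncard_eq_toFinset_card']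
  congr 1
  ext x
  simp

theorem card_lines_through (p : Pl.Point) :
    ({ℓ | ℓ ∈ Pl.L ∧ p ∈ ℓ} : Finset (Set Pl.Point)).card = q + 1 := by
  rw [← Pl.point_card p, Set.ncard_eq_toFinset_card']
  congr 1
  ext x
  simp

theorem card_inter {ℓ m : Set Pl.Point} (hℓ : ℓ ∈ Pl.L) (hm : m ∈ Pl.L) (h : ℓ ≠ m) :
    ({x | x ∈ ℓ ∧ x ∈ m} : Finset Pl.Point).card = 1 := by
  obtain ⟨x, hx, hx'⟩ := Pl.unique_point ℓ m hℓ hm h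
  rw [Finset.card_eq_one]
  refine ⟨x, ?_⟩
  ext y
  simp only [Finset.mem_filter, Finset.mem_univ, true_and, Finset.mem_singleton]
  exact ⟨hx' y, by rintro rfl; exact hx⟩

variable (Pl) in
theorem card_points : (Fintype.card Pl.Point : ℤ) = (q : ℤ) ^ 2 + q + 1 := by
  obtain ⟨p, -⟩ := Pl.nondegenerate
  have h := Finset.card_eq_sum_card_fiberwise (s := (Finset.univ.erase p : Finset Pl.Point))
    (t := ({ℓ | ℓ ∈ Pl.L ∧ p ∈ ℓ} : Finset (Set Pl.Point))) (f := fun x => line p x)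
    (fun x _ => by simp [line_mem])
  rw [Finset.sum_congr rfl (g := fun _ => q)] at h
  · rw [Finset.sum_const, card_lines_through, Finset.card_erase_of_mem (Finset.mem_univ p),
      Finset.card_univ, smul_eq_mul] at h
    have h0 : 0 < Fintype.card Pl.Point := Fintype.card_pos_iff.2 ⟨p⟩
    have : Fintype.card Pl.Point = (q + 1) * q + 1 := by lia
    rw [this]
    push_cast
    ring
  · intro ℓ hℓ
    simp only [Finset.mem_filter, Finset.mem_univ, true_and] at hℓ
    have : ((Finset.univ.erase p : Finset Pl.Point).filter fun x => line p x = ℓ) =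
        ({x | x ∈ ℓ} : Finset Pl.Point).erase p := by
      ext x
      simp only [Finset.mem_filter, Finset.mem_erase, Finset.mem_univ, true_and, and_true]
      refine and_congr_right fun hx => ⟨?_, fun h => (eq_line hx.symm hℓ.1 hℓ.2 h).symm⟩
      rintro rfl
      simp
    rw [this, Finset.card_erase_of_mem (by simp [hℓ.2]), card_line hℓ.1]
    rfl

/-- A sequence of distinct points, no three of which are collinear. -/
def IsArc {n : ℕ} (p : Fin n → Pl.Point) : Prop :=
  Function.Injective p ∧
    ∀ i j k : Fin n, i ≠ j → i ≠ k → j ≠ k → ¬ Pl.Collinear {p i, p j, p k}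

theorem IsArc.mem_line_iff {n : ℕ} {p : Fin n → Pl.Point} (hp : IsArc p) {i j k : Fin n}
    (hjk : j ≠ k) : p i ∈ line (p j) (p k) ↔ i = j ∨ i = k := by
  constructor
  · intro h
    by_contra! hc
    exact hp.2 i j k hc.1 hc.2 hjk ((collinear_iff (hp.1.ne hjk)).2 h)
  · rintro (rfl | rfl) <;> simp

theorem IsArc.comp {n m : ℕ} {p : Fin n → Pl.Point} (hp : IsArc p) {σ : Fin m → Fin n}
    (hσ : Function.Injective σ) : IsArc (p ∘ σ) :=
  ⟨hp.1.comp hσ, fun _ _ _ hij hik hjk => hp.2 _ _ _ (hσ.ne hij) (hσ.ne hik) (hσ.ne hjk)⟩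

/-- The point `x` is neither one of the points `p i` nor on a line joining two of them. -/
def Extends {n : ℕ} (p : Fin n → Pl.Point) (x : Pl.Point) : Prop :=
  (∀ i, x ≠ p i) ∧ ∀ i j, i < j → x ∉ line (p i) (p j)

theorem isArc_snoc {n : ℕ} {p : Fin n → Pl.Point} {x : Pl.Point} :
    IsArc (Fin.snoc p x : Fin (n + 1) → Pl.Point) ↔ IsArc p ∧ Extends p x := by
  constructor
  · intro h
    have hp : IsArc p := by
      have := h.comp (Fin.castSucc_injective n)
      rwa [show (Fin.snoc p x : Fin (n + 1) → Pl.Point) ∘ Fin.castSucc = p by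
        ext i; simp] at this
    refine ⟨hp, fun i hi => ?_, fun i j hij hx => ?_⟩
    · have := h.1 (a₁ := Fin.last n) (a₂ := i.castSucc) (by simpa using hi)
      exact absurd this (Fin.castSucc_lt_last i).ne'
    · have := h.mem_line_iff (i := Fin.last n) (j := i.castSucc) (k := j.castSucc)
        (by simpa using hij.ne)
      simp only [Fin.snoc_last, Fin.snoc_castSucc, hx, true_iff] at this
      rcases this with h | h
      · exact absurd h (Fin.castSucc_lt_last i).ne'
      · exact absurd h (Fin.castSucc_lt_last j).ne'
  · rintro ⟨hp, hx, hl⟩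
    have hl' : ∀ i j, i ≠ j → ¬ Pl.Collinear {x, p i, p j} := by
      intro i j hij
      rw [collinear_iff (hp.1.ne hij)]
      rcases lt_or_gt_of_ne hij with h | h
      · exact hl i j h
      · rw [line_comm (hp.1.ne hij)]
        exact hl j i h
    constructor
    · rw [Fin.snoc_injective_iff]
      exact ⟨hp.1, by rintro ⟨i, hi⟩; exact hx i hi.symm⟩
    · intro i j k
      induction i using Fin.lastCases with
      | last =>
        induction j using Fin.lastCases with
        | last => simp
        | cast j =>
          induction k using Fin.lastCases with
          | last => simp
          | cast k =>
            intro _ _ h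
            simpa using hl' j k (by simpa using h)
      | cast i =>
        induction j using Fin.lastCases with
        | last =>
          induction k using Fin.lastCases with
          | last => simp
          | cast k =>
            intro _ h _
            rw [Set.insert_comm]
            simpa using hl' i k (by simpa using h)
        | cast j =>
          induction k using Fin.lastCases with
          | last =>
            intro h _ _
            rw [Set.pair_comm, Set.insert_comm]
            simpa using hl' i j (by simpa using h)
          | cast k =>
            intro h₁ h₂ h₃
            simpa using hp.2 i j k (by simpa using h₁) (by simpa using h₂) (by simpa using h₃)

theorem sum_snoc {n : ℕ} (f : (Fin (n + 1) → Pl.Point) → ℤ) :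
    ∑ p, f p = ∑ p : Fin n → Pl.Point, ∑ x, f (Fin.snoc p x) := by
  rw [← (Fin.snocEquiv fun _ => Pl.Point).sum_comp f, Fintype.sum_prod_type_right]
  rfl

theorem nArcs_eq_sum (n : ℕ) :
    (Pl.nArcs n : ℤ) = ∑ p : Fin n → Pl.Point, if IsArc p then 1 else 0 := by
  rw [nArcs, Nat.card_eq_fintype_card, Fintype.card_subtype, Finset.sum_boole]
  congr!

theorem nArcs_succ (n : ℕ) :
    (Pl.nArcs (n + 1) : ℤ) = ∑ p : Fin n → Pl.Point,
      if IsArc p then ((Finset.univ.filter (Extends p)).card : ℤ) else 0 := by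
  rw [nArcs_eq_sum, sum_snoc]
  refine Finset.sum_congr rfl fun p _ => ?_
  by_cases hp : IsArc p <;> simp [isArc_snoc, hp]

/-- The pairs of indices `i < j`, which index the secants of an arc. -/
def pairs (n : ℕ) : Finset (Fin n × Fin n) := {e | e.1 < e.2}

/-- Two pairs of indices without a common index. -/
def DisjointPairs {n : ℕ} (e f : Fin n × Fin n) : Prop :=
  e.1 ≠ f.1 ∧ e.1 ≠ f.2 ∧ e.2 ≠ f.1 ∧ e.2 ≠ f.2

instance {n : ℕ} (e f : Fin n × Fin n) : Decidable (DisjointPairs e f) :=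
  inferInstanceAs (Decidable (_ ∧ _))

/-- The sets of `k` pairwise disjoint pairs of indices. -/
def matchings (n k : ℕ) : Finset (Finset (Fin n × Fin n)) :=
  ((pairs n).powersetCard k).filter fun t => ∀ e ∈ t, ∀ f ∈ t, e ≠ f → DisjointPairs e f

/-- The secant of the sequence `p` indexed by the pair `e`. -/
noncomputable def secant {n : ℕ} (p : Fin n → Pl.Point) (e : Fin n × Fin n) : Set Pl.Point :=
  line (p e.1) (p e.2)

theorem secant_mem {n : ℕ} (p : Fin n → Pl.Point) (e : Fin n × Fin n) : secant p e ∈ Pl.L :=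
  line_mem _ _

theorem mem_pairs {n : ℕ} {e : Fin n × Fin n} : e ∈ pairs n ↔ e.1 < e.2 := by
  simp [pairs]

theorem IsArc.mem_secant_iff {n : ℕ} {p : Fin n → Pl.Point} (hp : IsArc p) {i : Fin n}
    {e : Fin n × Fin n} (he : e ∈ pairs n) : p i ∈ secant p e ↔ i = e.1 ∨ i = e.2 :=
  hp.mem_line_iff (mem_pairs.1 he).ne

theorem IsArc.secant_injOn {n : ℕ} {p : Fin n → Pl.Point} (hp : IsArc p)
    {e f : Fin n × Fin n} (he : e ∈ pairs n) (hf : f ∈ pairs n) (h : secant p e = secant p f) :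
    e = f := by
  have h1 := (hp.mem_secant_iff (i := e.1) hf).1 (by rw [← h]; simp [secant])
  have h2 := (hp.mem_secant_iff (i := e.2) hf).1 (by rw [← h]; simp [secant])
  rw [mem_pairs] at he hf
  ext <;> grind

/-- Two secants of an arc that meet off the arc have disjoint index pairs. -/
theorem IsArc.disjointPairs {n : ℕ} {p : Fin n → Pl.Point} (hp : IsArc p)
    {e f : Fin n × Fin n} (he : e ∈ pairs n) (hf : f ∈ pairs n) (h : e ≠ f) {x : Pl.Point}
    (hx : ∀ i, x ≠ p i) (hxe : x ∈ secant p e) (hxf : x ∈ secant p f) : DisjointPairs e f := by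
  have key : ∀ i, p i ∈ secant p e → p i ∈ secant p f → False := fun i h1 h2 =>
    hx i (point_unique (secant_mem p e) (secant_mem p f)
      (fun h' => h (hp.secant_injOn he hf h')) hxe hxf h1 h2)
  refine ⟨fun h' => key e.1 ?_ ?_, fun h' => key e.1 ?_ ?_, fun h' => key e.2 ?_ ?_,
    fun h' => key e.2 ?_ ?_⟩ <;> first | simp [secant]; done | rw [h']; simp [secant]

/-- Two secants of an arc with disjoint index pairs meet off the arc. -/
theorem IsArc.ne_of_disjointPairs {n : ℕ} {p : Fin n → Pl.Point} (hp : IsArc p)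
    {e f : Fin n × Fin n} (he : e ∈ pairs n) (hf : f ∈ pairs n) (h : DisjointPairs e f)
    {x : Pl.Point} (hxe : x ∈ secant p e) (hxf : x ∈ secant p f) (i : Fin n) : x ≠ p i := by
  rintro rfl
  rw [hp.mem_secant_iff he] at hxe
  rw [hp.mem_secant_iff hf] at hxf
  unfold DisjointPairs at h
  grind

theorem two_mul_card_le {n : ℕ} {s : Finset (Fin n × Fin n)} (hs : s ⊆ pairs n)
    (h : ∀ e ∈ s, ∀ f ∈ s, e ≠ f → DisjointPairs e f) : 2 * s.card ≤ n := by
  have h1 : (s.biUnion fun e => {e.1, e.2}).card = ∑ e ∈ s, ({e.1, e.2} : Finset (Fin n)).card := by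
    refine Finset.card_biUnion fun e he f hf hef => ?_
    have := h e he f hf hef
    unfold DisjointPairs at this
    rw [Function.onFun, Finset.disjoint_left]
    simp
    grind
  rw [Finset.sum_congr rfl (g := fun _ => 2)
    (fun e he => Finset.card_pair (mem_pairs.1 (hs he)).ne)] at h1
  have h2 := Finset.card_le_univ (s.biUnion fun e => ({e.1, e.2} : Finset (Fin n)))
  simp at h1 h2
  lia

/-- The number of points on `k` pairwise disjoint secants, summed over the choices of these. -/
noncomputable def meetCount {n : ℕ} (p : Fin n → Pl.Point) (k : ℕ) : ℤ :=
  ∑ t ∈ matchings n k, (({x | ∀ e ∈ t, x ∈ secant p e} : Finset Pl.Point).card : ℤ)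

theorem sum_choose_eq_meetCount {n : ℕ} {p : Fin n → Pl.Point} (hp : IsArc p) {k : ℕ}
    (hk : 2 ≤ k) : ∑ x with ∀ i, x ≠ p i,
      ((((pairs n).filter fun e => x ∈ secant p e).card.choose k : ℕ) : ℤ) = meetCount p k := by
  have h1 : ∀ x ∈ ({x | ∀ i, x ≠ p i} : Finset Pl.Point),
      ((((pairs n).filter fun e => x ∈ secant p e).card.choose k : ℕ) : ℤ) =
        ∑ t ∈ matchings n k, if ∀ e ∈ t, x ∈ secant p e then 1 else 0 := by
    intro x hx
    simp only [Finset.mem_filter, Finset.mem_univ, true_and] at hx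
    rw [Finset.sum_boole, ← Finset.card_powersetCard]
    congr 2
    ext t
    simp only [matchings, Finset.mem_filter, Finset.mem_powersetCard, Finset.subset_iff]
    constructor
    · rintro ⟨ht, hc⟩
      exact ⟨⟨⟨fun e he => (ht he).1, hc⟩, fun e he f hf hef =>
        hp.disjointPairs (ht he).1 (ht hf).1 hef hx (ht he).2 (ht hf).2⟩, fun e he => (ht he).2⟩
    · rintro ⟨⟨⟨ht, hc⟩, -⟩, h⟩
      exact ⟨fun e he => ⟨ht he, h e he⟩, hc⟩
  rw [Finset.sum_congr rfl h1, Finset.sum_comm, meetCount]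
  refine Finset.sum_congr rfl fun t ht => ?_
  rw [Finset.sum_boole, Finset.filter_filter]
  congr 2
  ext x
  simp only [Finset.mem_filter, Finset.mem_univ, true_and, and_iff_right_iff_imp]
  intro hx
  simp only [matchings, Finset.mem_filter, Finset.mem_powersetCard, Finset.subset_iff] at ht
  obtain ⟨e, he, f, hf, hef⟩ := Finset.one_lt_card.1 (show 1 < t.card by lia)
  exact hp.ne_of_disjointPairs (ht.1.1 he) (ht.1.1 hf) (ht.2 e he f hf hef) (hx e he) (hx f hf)

theorem IsArc.meetCount_two {n : ℕ} {p : Fin n → Pl.Point} (hp : IsArc p) :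
    meetCount p 2 = (matchings n 2).card := by
  rw [meetCount, Finset.card_eq_sum_ones, Nat.cast_sum]
  refine Finset.sum_congr rfl fun t ht => ?_
  simp only [matchings, Finset.mem_filter, Finset.mem_powersetCard, Finset.subset_iff] at ht
  obtain ⟨e, f, hef, rfl⟩ := Finset.card_eq_two.1 ht.1.2
  norm_cast
  rw [← card_inter (secant_mem p e) (secant_mem p f)
    fun h => hef (hp.secant_injOn (ht.1.1 (by simp)) (ht.1.1 (by simp)) h)]
  congr 2
  ext x
  simp

theorem IsArc.sum_card_secants {n : ℕ} {p : Fin n → Pl.Point} (hp : IsArc p) :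
    ∑ x with ∀ i, x ≠ p i, (((pairs n).filter fun e => x ∈ secant p e).card : ℤ) =
      (pairs n).card * ((q : ℤ) - 1) := by
  simp_rw [← Finset.sum_boole]
  rw [Finset.sum_comm, ← nsmul_eq_mul, ← Finset.sum_const]
  refine Finset.sum_congr rfl fun e he => ?_
  rw [Finset.sum_boole, Finset.filter_filter]
  have : ({x | (∀ i, x ≠ p i) ∧ x ∈ secant p e} : Finset Pl.Point) =
      ({x | x ∈ secant p e} : Finset Pl.Point) \ {p e.1, p e.2} := by
    ext x
    simp only [Finset.mem_filter, Finset.mem_univ, true_and, Finset.mem_sdiff,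
      Finset.mem_insert, Finset.mem_singleton]
    constructor
    · rintro ⟨h1, h2⟩
      exact ⟨h2, fun h => h.elim (h1 _) (h1 _)⟩
    · rintro ⟨h1, h2⟩
      refine ⟨?_, h1⟩
      rintro i rfl
      rw [hp.mem_secant_iff he] at h1
      exact h2 (h1.imp (congrArg p) (congrArg p))
  have hne : p e.1 ≠ p e.2 := hp.1.ne (mem_pairs.1 he).ne
  rw [this, Finset.card_sdiff_of_subset, card_line (secant_mem p e), Finset.card_pair hne]
  · have : 2 ≤ q + 1 := by
      rw [← card_line (secant_mem p e), ← Finset.card_pair hne]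
      apply Finset.card_le_card
      intro x
      simp only [Finset.mem_insert, Finset.mem_singleton, Finset.mem_filter, Finset.mem_univ,
        true_and]
      rintro (rfl | rfl) <;> simp [secant]
    lia
  · intro x
    simp only [Finset.mem_insert, Finset.mem_singleton, Finset.mem_filter, Finset.mem_univ,
      true_and]
    rintro (rfl | rfl) <;> simp [secant]

/-- The number of points extending an arc of size at most six. -/
theorem IsArc.card_extends {n : ℕ} (hn : n ≤ 6) {p : Fin n → Pl.Point} (hp : IsArc p) :
    ((Finset.univ.filter (Extends p)).card : ℤ) =
      (q : ℤ) ^ 2 + q + 1 - n - (pairs n).card * ((q : ℤ) - 1) + (matchings n 2).card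
        - meetCount p 3 := by
  have hoff : (({x | ∀ i, x ≠ p i} : Finset Pl.Point).card : ℤ) = (q : ℤ) ^ 2 + q + 1 - n := by
    have h1 : ({x | ∀ i, x ≠ p i} : Finset Pl.Point) = (Finset.univ.image p)ᶜ := by
      ext x
      simp [eq_comm]
    have h2 : (Finset.univ.image p).card = n := by
      rw [Finset.card_image_of_injective _ hp.1, Finset.card_univ, Fintype.card_fin]
    rw [h1, Finset.card_compl, Nat.cast_sub (Finset.card_le_univ _), h2, card_points]
  have h1 : (Finset.univ.filter (Extends p)) = ({x | ∀ i, x ≠ p i} : Finset Pl.Point).filter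
      fun x => (pairs n).filter (fun e => x ∈ secant p e) = ∅ := by
    ext x
    simp only [Finset.filter_eq_empty_iff]
    simp [Extends, mem_pairs, secant]
  rw [← hoff, ← hp.meetCount_two, ← sum_choose_eq_meetCount hp (le_refl 2),
    ← sum_choose_eq_meetCount hp (show 2 ≤ 3 by simp), ← hp.sum_card_secants, h1,
    ← Finset.sum_boole, Finset.card_eq_sum_ones, Nat.cast_sum, ← Finset.sum_sub_distrib,
    ← Finset.sum_add_distrib, ← Finset.sum_sub_distrib]
  refine Finset.sum_congr rfl fun x hx => ?_
  simp only [Finset.mem_filter, Finset.mem_univ, true_and] at hx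
  have h3 : 2 * ((pairs n).filter fun e => x ∈ secant p e).card ≤ n := by
    refine two_mul_card_le (Finset.filter_subset _ _) fun e he f hf hef => ?_
    rw [Finset.mem_filter] at he hf
    exact hp.disjointPairs he.1 hf.1 hef hx he.2 hf.2
  simp_rw [← Finset.card_eq_zero]
  generalize ((pairs n).filter fun e => x ∈ secant p e).card = s at h3
  have : s ≤ 3 := by lia
  interval_cases s <;> simp [Nat.choose]

theorem matchings_three_eq_empty {n : ℕ} (hn : n ≤ 5) : matchings n 3 = ∅ := by
  rw [Finset.eq_empty_iff_forall_notMem]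
  intro t ht
  simp only [matchings, Finset.mem_filter, Finset.mem_powersetCard] at ht
  have := two_mul_card_le ht.1.1 ht.2
  lia

theorem nArcs_succ_eq_mul {n : ℕ} (hn : n ≤ 5) :
    (Pl.nArcs (n + 1) : ℤ) = Pl.nArcs n * ((q : ℤ) ^ 2 + q + 1 - n
      - (pairs n).card * ((q : ℤ) - 1) + (matchings n 2).card) := by
  rw [nArcs_succ, nArcs_eq_sum, Finset.sum_mul]
  refine Finset.sum_congr rfl fun p _ => ?_
  by_cases hp : IsArc p
  · simp [hp, hp.card_extends (hn.trans (by simp)), meetCount, matchings_three_eq_empty hn]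
  · simp [hp]

theorem nArcs_four :
    (Pl.nArcs 4 : ℤ) = ((q : ℤ) ^ 2 + q + 1) * ((q : ℤ) ^ 2 + q) * (q : ℤ) ^ 2 *
      ((q : ℤ) - 1) ^ 2 := by
  have h0 : Pl.nArcs 0 = 1 := by
    rw [nArcs, Nat.card_eq_one_iff_unique]
    refine ⟨inferInstance, ⟨⟨Fin.elim0, fun i => i.elim0, fun i => i.elim0⟩⟩⟩
  rw [nArcs_succ_eq_mul (by simp), nArcs_succ_eq_mul (by simp), nArcs_succ_eq_mul (by simp),
    nArcs_succ_eq_mul (by simp), h0, show (pairs 0).card = 0 by decide,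
    show (pairs 1).card = 0 by decide, show (pairs 2).card = 1 by decide,
    show (pairs 3).card = 3 by decide, show (matchings 0 2).card = 0 by decide,
    show (matchings 1 2).card = 0 by decide, show (matchings 2 2).card = 0 by decide,
    show (matchings 3 2).card = 0 by decide +kernel]
  push_cast
  ring

theorem nArcs_six :
    (Pl.nArcs 6 : ℤ) = Pl.nArcs 4 * ((q : ℤ) - 2) * ((q : ℤ) - 3) * ((q : ℤ) ^ 2 - 9 * q + 21) := by
  rw [nArcs_succ_eq_mul (by simp), nArcs_succ_eq_mul (by simp),
    show (pairs 4).card = 6 by decide, show (pairs 5).card = 10 by decide,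
    show (matchings 4 2).card = 3 by decide +kernel,
    show (matchings 5 2).card = 15 by decide +kernel]
  push_cast
  ring

theorem nArcs_seven :
    (Pl.nArcs 7 : ℤ) = Pl.nArcs 6 * ((q : ℤ) ^ 2 - 14 * q + 55) -
      ∑ p : Fin 6 → Pl.Point, if IsArc p then meetCount p 3 else 0 := by
  rw [nArcs_succ, nArcs_eq_sum, Finset.sum_mul, ← Finset.sum_sub_distrib]
  refine Finset.sum_congr rfl fun p _ => ?_
  by_cases hp : IsArc p
  · simp only [hp, if_true, hp.card_extends le_rfl, show (pairs 6).card = 15 by decide,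
      show (matchings 6 2).card = 45 by decide +kernel]
    push_cast
    ring
  · simp [hp]

/-- The number of points on the three lines joining consecutive points of a sextuple. -/
noncomputable def brianchon (p : Fin 6 → Pl.Point) : ℤ :=
  (({x | x ∈ line (p 0) (p 1) ∧ x ∈ line (p 2) (p 3) ∧ x ∈ line (p 4) (p 5)} :
    Finset Pl.Point).card : ℤ)

theorem sum_meetCount_three :
    (∑ p : Fin 6 → Pl.Point, if IsArc p then meetCount p 3 else 0) =
      15 * ∑ p : Fin 6 → Pl.Point, if IsArc p then brianchon p else 0 := by
  have h1 : ∀ p : Fin 6 → Pl.Point, (if IsArc p then meetCount p 3 else 0) =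
      ∑ t ∈ matchings 6 3, if IsArc p then
        (({x | ∀ e ∈ t, x ∈ secant p e} : Finset Pl.Point).card : ℤ) else 0 := by
    intro p
    by_cases hp : IsArc p <;> simp [hp, meetCount]
  simp_rw [h1]
  rw [Finset.sum_comm, Finset.sum_congr rfl
    (g := fun _ => ∑ p : Fin 6 → Pl.Point, if IsArc p then brianchon p else 0),
    Finset.sum_const, show (matchings 6 3).card = 15 by decide +kernel, nsmul_eq_mul]
  · rfl
  intro t ht
  simp only [matchings, Finset.mem_filter, Finset.mem_powersetCard, Finset.subset_iff] at ht
  obtain ⟨⟨hp, hc⟩, hd⟩ := ht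
  obtain ⟨e, f, g, hef, heg, hfg, rfl⟩ := Finset.card_eq_three.1 hc
  have he := mem_pairs.1 (hp (x := e) (by simp))
  have hf := mem_pairs.1 (hp (x := f) (by simp))
  have hg := mem_pairs.1 (hp (x := g) (by simp))
  have h1 := hd e (by simp) f (by simp) hef
  have h2 := hd e (by simp) g (by simp) heg
  have h3 := hd f (by simp) g (by simp) hfg
  have hinj : Function.Injective ![e.1, e.2, f.1, f.2, g.1, g.2] := by
    unfold DisjointPairs at h1 h2 h3
    intro i j
    fin_cases i <;> fin_cases j <;> simp <;> grind
  let σ : Fin 6 ≃ Fin 6 :=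
    Equiv.ofBijective _ (Finite.injective_iff_bijective.1 hinj)
  refine Eq.trans ?_ ((Equiv.arrowCongr σ.symm (Equiv.refl Pl.Point)).sum_comp _)
  refine Finset.sum_congr rfl fun p _ => ?_
  have h4 : (Equiv.arrowCongr σ.symm (Equiv.refl Pl.Point)) p = p ∘ σ := rfl
  have h5 : IsArc (p ∘ σ) ↔ IsArc p := by
    refine ⟨fun h => ?_, fun h => h.comp σ.injective⟩
    simpa [Function.comp_assoc] using h.comp σ.symm.injective
  rw [h4]
  simp only [h5]
  congr 2
  simp [σ, secant]
  congr!

theorem extends_snoc {n : ℕ} {p : Fin n → Pl.Point} {a b : Pl.Point} :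
    Extends (Fin.snoc p a : Fin (n + 1) → Pl.Point) b ↔
      Extends p b ∧ b ≠ a ∧ ∀ i, b ∉ line (p i) a := by
  have h : ∀ i : Fin n, i.castSucc < Fin.last n := Fin.castSucc_lt_last
  have h' : ∀ i : Fin n, ¬ Fin.last n < i.castSucc := fun i => (h i).not_gt
  simp only [Extends, Fin.forall_fin_succ', Fin.snoc_castSucc, Fin.snoc_last,
    Fin.castSucc_lt_castSucc_iff, h, h', lt_irrefl, forall_true_left, false_imp_iff, forall_and,
    implies_true, and_true]
  tauto

theorem extends_four_iff {p : Fin 4 → Pl.Point} {x : Pl.Point} :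
    Extends p x ↔ x ∉ line (p 0) (p 1) ∧ x ∉ line (p 2) (p 3) ∧ x ∉ line (p 0) (p 2) ∧
      x ∉ line (p 1) (p 3) ∧ x ∉ line (p 0) (p 3) ∧ x ∉ line (p 1) (p 2) := by
  constructor
  · intro h
    exact ⟨h.2 _ _ (by decide), h.2 _ _ (by decide), h.2 _ _ (by decide), h.2 _ _ (by decide),
      h.2 _ _ (by decide), h.2 _ _ (by decide)⟩
  · rintro ⟨h1, h2, h3, h4, h5, h6⟩
    constructor
    · intro i
      rintro rfl
      fin_cases i <;> simp at h1 h2 h3 h4 h5 h6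
    · intro i j hij
      fin_cases i <;> fin_cases j <;> first | exact absurd hij (by decide) | assumption

/-- The points of the line `ℓ` that extend the sequence `p`. -/
noncomputable def extendsOn {n : ℕ} (p : Fin n → Pl.Point) (ℓ : Set Pl.Point) :
    Finset Pl.Point := {x | x ∈ ℓ ∧ Extends p x}

/-- The lines joining a point of a quadrangle `p` to the diagonal point `d` are two of its sides. -/
theorem IsArc.notMem_of_extends {p : Fin 4 → Pl.Point} (hp : IsArc p) {d : Pl.Point}
    {ℓ : Set Pl.Point} (hd1 : d ∈ line (p 0) (p 1)) (hd2 : d ∈ line (p 2) (p 3)) (hℓ : ℓ ∈ Pl.L)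
    (hdℓ : d ∈ ℓ) (h1 : ℓ ≠ line (p 0) (p 1)) (h2 : ℓ ≠ line (p 2) (p 3)) (i : Fin 4) :
    p i ∉ ℓ := by
  intro hi
  have key : ∀ j k, j ≠ k → (i = j ∨ i = k) → d ∈ line (p j) (p k) → p i ≠ d →
      ℓ = line (p j) (p k) := by
    intro j k hjk hi' hd hid
    refine line_unique hid hℓ (line_mem _ _) hi hdℓ ?_ hd
    rcases hi' with rfl | rfl <;> simp
  have hid : p i ≠ d := by
    rintro rfl
    rw [hp.mem_line_iff (by decide)] at hd1 hd2
    omega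
  by_cases h : i = 0 ∨ i = 1
  · exact h1 (key 0 1 (by decide) h hd1 hid)
  · exact h2 (key 2 3 (by decide) (by omega) hd2 hid)

/-- A quadrangle whose diagonal points are collinear. -/
def IsFanoQuad (p : Fin 4 → Pl.Point) : Prop :=
  IsArc p ∧ ∃ x y z, x ∈ line (p 0) (p 1) ∧ x ∈ line (p 2) (p 3) ∧ y ∈ line (p 0) (p 2) ∧
    y ∈ line (p 1) (p 3) ∧ z ∈ line (p 0) (p 3) ∧ z ∈ line (p 1) (p 2) ∧ Pl.Collinear {x, y, z}

theorem IsArc.line_ne {n : ℕ} {p : Fin n → Pl.Point} (hp : IsArc p) (i j k l : Fin n)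
    (hkl : k ≠ l := by decide) (h : ¬ ((i = k ∨ i = l) ∧ (j = k ∨ j = l)) := by decide) :
    line (p i) (p j) ≠ line (p k) (p l) := by
  intro h'
  apply h
  rw [← hp.mem_line_iff hkl, ← hp.mem_line_iff hkl, ← h']
  simp

theorem ite_and_not_eq {A B B' C C' : Prop} (h1 : A → ¬ B) (h2 : A → ¬ B') (h3 : A → ¬ C)
    (h4 : A → ¬ C') (h5 : B → ¬ C) (h6 : B → ¬ C') (h7 : C → ¬ B') (h8 : B' → ¬ C') :
    (if ¬ A ∧ ¬ A ∧ ¬ B ∧ ¬ B' ∧ ¬ C ∧ ¬ C' then (1 : ℤ) else 0) =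
      1 - (if A then 1 else 0) - (if B then 1 else 0) - (if B' then 1 else 0)
        - (if C then 1 else 0) - (if C' then 1 else 0) + (if B ∧ B' then 1 else 0)
        + (if C ∧ C' then 1 else 0) := by
  by_cases A
  · simp_all
  by_cases B
  · by_cases B' <;> simp_all
  by_cases B' <;> by_cases C <;> by_cases C' <;> simp_all

theorem IsArc.card_extendsOn {p : Fin 4 → Pl.Point} (hp : IsArc p) {d e f : Pl.Point}
    {ℓ : Set Pl.Point} (hd1 : d ∈ line (p 0) (p 1)) (hd2 : d ∈ line (p 2) (p 3))
    (he1 : e ∈ line (p 0) (p 2)) (he2 : e ∈ line (p 1) (p 3))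
    (hf1 : f ∈ line (p 0) (p 3)) (hf2 : f ∈ line (p 1) (p 2)) (hℓ : ℓ ∈ Pl.L)
    (hdℓ : d ∈ ℓ) (h1 : ℓ ≠ line (p 0) (p 1)) (h2 : ℓ ≠ line (p 2) (p 3)) :
    ((extendsOn p ℓ).card : ℤ) =
      q - 4 + (if e ∈ ℓ then 1 else 0) + (if f ∈ ℓ then 1 else 0) := by
  have hni := hp.notMem_of_extends hd1 hd2 hℓ hdℓ h1 h2
  have hsum : ∀ i j, ∑ x with x ∈ ℓ, (if x ∈ line (p i) (p j) then (1 : ℤ) else 0) = 1 := by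
    intro i j
    rw [Finset.sum_boole, Finset.filter_filter, card_inter hℓ (line_mem _ _)
      (fun h => hni i (by simp [h]))]
    rfl
  have hsum2 : ∀ {m m' : Set Pl.Point} {y : Pl.Point}, m ∈ Pl.L → m' ∈ Pl.L → m ≠ m' → y ∈ m →
      y ∈ m' → ∑ x with x ∈ ℓ, (if x ∈ m ∧ x ∈ m' then (1 : ℤ) else 0) =
        if y ∈ ℓ then 1 else 0 := by
    intro m m' y hm hm' hne hy hy'
    have : ∀ x, (x ∈ m ∧ x ∈ m') ↔ x = y := fun x =>
      ⟨fun h => point_unique hm hm' hne h.1 h.2 hy hy', by rintro rfl; exact ⟨hy, hy'⟩⟩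
    simp [this]
  have huniq : ∀ i x, x ∈ ℓ → ∀ m m', m ∈ Pl.L → m' ∈ Pl.L → m ≠ m' → p i ∈ m → p i ∈ m' →
      x ∈ m → x ∉ m' := by
    intro i x hx m m' hm hm' hne hi hi' h h'
    exact hni i (point_unique hm hm' hne h h' hi hi' ▸ hx)
  have hpt : ∀ x ∈ ({x | x ∈ ℓ} : Finset Pl.Point), (if Extends p x then (1 : ℤ) else 0) =
      1 - (if x ∈ line (p 0) (p 1) then 1 else 0) - (if x ∈ line (p 0) (p 2) then 1 else 0)
        - (if x ∈ line (p 1) (p 3) then 1 else 0) - (if x ∈ line (p 0) (p 3) then 1 else 0)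
        - (if x ∈ line (p 1) (p 2) then 1 else 0)
        + (if x ∈ line (p 0) (p 2) ∧ x ∈ line (p 1) (p 3) then 1 else 0)
        + (if x ∈ line (p 0) (p 3) ∧ x ∈ line (p 1) (p 2) then 1 else 0) := by
    intro x hx
    simp only [Finset.mem_filter, Finset.mem_univ, true_and] at hx
    have hx01 : x ∈ line (p 0) (p 1) → x = d := fun h =>
      point_unique hℓ (line_mem _ _) h1 hx h hdℓ hd1
    have hx23 : x ∈ line (p 2) (p 3) → x = d := fun h =>
      point_unique hℓ (line_mem _ _) h2 hx h hdℓ hd2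
    have e1 : x ∈ line (p 2) (p 3) ↔ x ∈ line (p 0) (p 1) :=
      ⟨fun h => hx23 h ▸ hd1, fun h => hx01 h ▸ hd2⟩
    have u1 := huniq 0 x hx _ _ (line_mem _ _) (line_mem _ _) (hp.line_ne 0 2 0 1).symm
      (by simp) (by simp)
    have u2 := huniq 1 x hx _ _ (line_mem _ _) (line_mem _ _) (hp.line_ne 0 1 1 3)
      (by simp) (by simp)
    have u3 := huniq 0 x hx _ _ (line_mem _ _) (line_mem _ _) (hp.line_ne 0 3 0 1).symm
      (by simp) (by simp)
    have u4 := huniq 1 x hx _ _ (line_mem _ _) (line_mem _ _) (hp.line_ne 0 1 1 2)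
      (by simp) (by simp)
    have u5 := huniq 0 x hx _ _ (line_mem _ _) (line_mem _ _) (hp.line_ne 0 2 0 3)
      (by simp) (by simp)
    have u6 := huniq 2 x hx _ _ (line_mem _ _) (line_mem _ _) (hp.line_ne 0 2 1 2)
      (by simp) (by simp)
    have u7 := huniq 3 x hx _ _ (line_mem _ _) (line_mem _ _) (hp.line_ne 0 3 1 3)
      (by simp) (by simp)
    have u8 := huniq 1 x hx _ _ (line_mem _ _) (line_mem _ _) (hp.line_ne 1 3 1 2)
      (by simp) (by simp)
    simp only [extends_four_iff, e1]
    exact ite_and_not_eq u1 u2 u3 u4 u5 u6 u7 u8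
  rw [extendsOn, ← Finset.filter_filter, ← Finset.sum_boole, Finset.sum_congr rfl hpt]
  simp only [Finset.sum_add_distrib, Finset.sum_sub_distrib, hsum,
    hsum2 (line_mem _ _) (line_mem _ _) (hp.line_ne 0 2 1 3) he1 he2,
    hsum2 (line_mem _ _) (line_mem _ _) (hp.line_ne 0 3 1 2) hf1 hf2,
    Finset.sum_const, card_line hℓ, nsmul_eq_mul]
  push_cast
  ring

theorem IsArc.exists_meet {n : ℕ} {p : Fin n → Pl.Point} (hp : IsArc p) (i j k l : Fin n)
    (hkl : k ≠ l := by decide) (h : ¬ ((i = k ∨ i = l) ∧ (j = k ∨ j = l)) := by decide) :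
    ∃ x, x ∈ line (p i) (p j) ∧ x ∈ line (p k) (p l) :=
  (Pl.unique_point _ _ (line_mem _ _) (line_mem _ _) (hp.line_ne i j k l hkl h)).exists

theorem IsArc.isFanoQuad_iff {p : Fin 4 → Pl.Point} (hp : IsArc p) {d e f : Pl.Point}
    (hd1 : d ∈ line (p 0) (p 1)) (hd2 : d ∈ line (p 2) (p 3))
    (he1 : e ∈ line (p 0) (p 2)) (he2 : e ∈ line (p 1) (p 3))
    (hf1 : f ∈ line (p 0) (p 3)) (hf2 : f ∈ line (p 1) (p 2)) :
    IsFanoQuad p ↔ Pl.Collinear {d, e, f} := by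
  refine ⟨fun ⟨_, x, y, z, hx1, hx2, hy1, hy2, hz1, hz2, h⟩ => ?_,
    fun h => ⟨hp, d, e, f, hd1, hd2, he1, he2, hf1, hf2, h⟩⟩
  rwa [point_unique (line_mem _ _) (line_mem _ _) (hp.line_ne 0 1 2 3) hd1 hd2 hx1 hx2,
    point_unique (line_mem _ _) (line_mem _ _) (hp.line_ne 0 2 1 3) he1 he2 hy1 hy2,
    point_unique (line_mem _ _) (line_mem _ _) (hp.line_ne 0 3 1 2) hf1 hf2 hz1 hz2]

/-- The points `p i` are not diagonal points. -/
theorem IsArc.ne_meet {n : ℕ} {p : Fin n → Pl.Point} (hp : IsArc p) {d : Pl.Point}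
    {i j k l : Fin n} (hd1 : d ∈ line (p i) (p j)) (hd2 : d ∈ line (p k) (p l)) (m : Fin n)
    (hij : i ≠ j := by decide) (hkl : k ≠ l := by decide)
    (h : ¬ ((m = i ∨ m = j) ∧ (m = k ∨ m = l)) := by decide) : d ≠ p m := by
  rintro rfl
  rw [hp.mem_line_iff hij] at hd1
  rw [hp.mem_line_iff hkl] at hd2
  exact h ⟨hd1, hd2⟩

theorem IsArc.sum_card_extendsOn {p : Fin 4 → Pl.Point} (hp : IsArc p) {d : Pl.Point}
    (hd1 : d ∈ line (p 0) (p 1)) (hd2 : d ∈ line (p 2) (p 3)) :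
    ∑ ℓ with ℓ ∈ Pl.L ∧ d ∈ ℓ, ((extendsOn p ℓ).card : ℤ) * ((extendsOn p ℓ).card - 1) =
      (q - 4) * (q - 3) ^ 2 + if IsFanoQuad p then 2 else 0 := by
  obtain ⟨e, he1, he2⟩ := hp.exists_meet 0 2 1 3
  obtain ⟨f, hf1, hf2⟩ := hp.exists_meet 0 3 1 2
  set T : Finset (Set Pl.Point) := {ℓ | ℓ ∈ Pl.L ∧ d ∈ ℓ} with hT
  have hsub : ({line (p 0) (p 1), line (p 2) (p 3)} : Finset (Set Pl.Point)) ⊆ T := by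
    intro ℓ
    simp only [hT, Finset.mem_insert, Finset.mem_singleton, Finset.mem_filter, Finset.mem_univ,
      true_and]
    rintro (rfl | rfl)
    · exact ⟨line_mem _ _, hd1⟩
    · exact ⟨line_mem _ _, hd2⟩
  set T' := T \ {line (p 0) (p 1), line (p 2) (p 3)} with hT'
  have hcard : (T'.card : ℤ) = q - 1 := by
    have h1 := Finset.card_sdiff_add_card_eq_card hsub
    rw [hT, card_lines_through, Finset.card_pair (hp.line_ne 0 1 2 3), ← hT, ← hT'] at h1
    lia
  have hmem : ∀ ℓ, ℓ ∈ T' ↔ (ℓ ∈ Pl.L ∧ d ∈ ℓ) ∧ ℓ ≠ line (p 0) (p 1) ∧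
      ℓ ≠ line (p 2) (p 3) := by
    intro ℓ
    simp [hT', hT]
  have hzero : ∀ ℓ ∈ T, ℓ ∉ T' →
      ((extendsOn p ℓ).card : ℤ) * ((extendsOn p ℓ).card - 1) = 0 := by
    intro ℓ h1 h2
    have h3 : ℓ = line (p 0) (p 1) ∨ ℓ = line (p 2) (p 3) := by
      by_contra! hc
      refine h2 ((hmem ℓ).2 ⟨by simpa [hT] using h1, hc⟩)
    have h4 : extendsOn p ℓ = ∅ := by
      rw [extendsOn, Finset.filter_eq_empty_iff]
      rintro x - ⟨h5, h6⟩
      rw [extends_four_iff] at h6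
      rcases h3 with rfl | rfl
      · exact h6.1 h5
      · exact h6.2.1 h5
    simp [h4]
  have hne : ∀ y, d ≠ y → y ∉ line (p 0) (p 1) → y ∉ line (p 2) (p 3) → ∀ ℓ,
      (ℓ ∈ T' ∧ y ∈ ℓ) ↔ ℓ = line d y := by
    intro y hdy hy1 hy2 ℓ
    rw [hmem]
    constructor
    · rintro ⟨⟨⟨h1, h2⟩, -⟩, h3⟩
      exact eq_line hdy h1 h2 h3
    · rintro rfl
      refine ⟨⟨⟨line_mem _ _, by simp⟩, fun h => hy1 ?_, fun h => hy2 ?_⟩, by simp⟩ <;> simp [← h]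
  have hoff : ∀ y m, m ∈ Pl.L → ∀ i j k, y ∈ m → p i ∈ m → p i ∈ line (p j) (p k) →
      m ≠ line (p j) (p k) → y ≠ p i → y ∉ line (p j) (p k) :=
    fun y m hm i j k hy h1 h2 h3 h4 h5 =>
      h4 (point_unique hm (line_mem _ _) h3 hy h5 h1 h2)
  have he01 : e ∉ line (p 0) (p 1) := hoff e _ (line_mem _ _) 0 0 1 he1 (by simp)
    (by simp) (hp.line_ne 0 2 0 1) (hp.ne_meet he1 he2 0)
  have he23 : e ∉ line (p 2) (p 3) := hoff e _ (line_mem _ _) 2 2 3 he1 (by simp)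
    (by simp) (hp.line_ne 0 2 2 3) (hp.ne_meet he1 he2 2)
  have hf01 : f ∉ line (p 0) (p 1) := hoff f _ (line_mem _ _) 0 0 1 hf1 (by simp)
    (by simp) (hp.line_ne 0 3 0 1) (hp.ne_meet hf1 hf2 0)
  have hf23 : f ∉ line (p 2) (p 3) := hoff f _ (line_mem _ _) 3 2 3 hf1 (by simp)
    (by simp) (hp.line_ne 0 3 2 3) (hp.ne_meet hf1 hf2 3)
  have hef : e ≠ f := by
    rintro rfl
    have h0 : e ≠ p 0 := hp.ne_meet he1 he2 0
    exact h0
      (point_unique (line_mem _ _) (line_mem _ _) (hp.line_ne 0 2 0 3) he1 hf1 (by simp) (by simp))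
  have hde : d ≠ e := by rintro rfl; exact he01 hd1
  have hdf : d ≠ f := by rintro rfl; exact hf01 hd1
  have hsum : ∀ y, d ≠ y → y ∉ line (p 0) (p 1) → y ∉ line (p 2) (p 3) →
      ∑ ℓ ∈ T', (if y ∈ ℓ then (1 : ℤ) else 0) = 1 := by
    intro y h1 h2 h3
    rw [Finset.sum_boole, show T'.filter (fun ℓ => y ∈ ℓ) = {line d y} by
      ext ℓ; simpa using hne y h1 h2 h3 ℓ]
    simp
  have hsum2 : ∑ ℓ ∈ T', (if e ∈ ℓ ∧ f ∈ ℓ then (1 : ℤ) else 0) =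
      if IsFanoQuad p then 1 else 0 := by
    rw [Finset.sum_boole, hp.isFanoQuad_iff hd1 hd2 he1 he2 hf1 hf2, collinear_iff hef]
    have h1 : T'.filter (fun ℓ => e ∈ ℓ ∧ f ∈ ℓ) = if d ∈ line e f then {line d e} else ∅ := by
      ext ℓ
      rw [Finset.mem_filter, ← and_assoc, hne e hde he01 he23 ℓ]
      split_ifs with h
      · rw [Finset.mem_singleton, and_iff_left_iff_imp]
        rintro rfl
        rw [← eq_line hde (line_mem e f) h (by simp)]
        simp
      · simp only [Finset.notMem_empty, iff_false, not_and]
        rintro rfl h2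
        apply h
        rw [← eq_line hef (line_mem d e) (by simp) h2]
        simp
    rw [h1]
    split_ifs <;> simp
  rw [← Finset.sum_subset Finset.sdiff_subset hzero, Finset.sum_congr rfl (g := fun ℓ =>
    ((q : ℤ) - 4) * (q - 5) + (2 * q - 8) * (if e ∈ ℓ then 1 else 0) +
      (2 * q - 8) * (if f ∈ ℓ then 1 else 0) + 2 * (if e ∈ ℓ ∧ f ∈ ℓ then 1 else 0))]
  · rw [← hT']
    simp only [Finset.sum_add_distrib, ← Finset.mul_sum, hsum2, hsum e hde he01 he23,
      hsum f hdf hf01 hf23, Finset.sum_const, nsmul_eq_mul, hcard]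
    split_ifs <;> ring
  · intro ℓ hℓ
    rw [hmem] at hℓ
    rw [hp.card_extendsOn hd1 hd2 he1 he2 hf1 hf2 hℓ.1.1 hℓ.1.2 hℓ.2.1 hℓ.2.2]
    by_cases h1 : e ∈ ℓ <;> by_cases h2 : f ∈ ℓ <;>
      simp only [h1, h2, if_true, if_false, and_self, and_true, and_false] <;> ring

theorem brianchon_snoc {p : Fin 4 → Pl.Point} (hp : IsArc p) {d : Pl.Point}
    (hd1 : d ∈ line (p 0) (p 1)) (hd2 : d ∈ line (p 2) (p 3)) (a b : Pl.Point) :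
    brianchon (Fin.snoc (Fin.snoc p a : Fin 5 → Pl.Point) b) =
      if d ∈ line a b then 1 else 0 := by
  have h : ({x | x ∈ line (p 0) (p 1) ∧ x ∈ line (p 2) (p 3) ∧ x ∈ line a b} :
      Finset Pl.Point) = if d ∈ line a b then {d} else ∅ := by
    ext x
    simp only [Finset.mem_filter, Finset.mem_univ, true_and]
    have h1 : x ∈ line (p 0) (p 1) → x ∈ line (p 2) (p 3) → x = d := fun h1 h2 =>
      point_unique (line_mem _ _) (line_mem _ _) (hp.line_ne 0 1 2 3) h1 h2 hd1 hd2
    split_ifs with h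
    · rw [Finset.mem_singleton]
      exact ⟨fun h => h1 h.1 h.2.1, by rintro rfl; exact ⟨hd1, hd2, h⟩⟩
    · simp only [Finset.notMem_empty, iff_false]
      rintro ⟨h2, h3, h4⟩
      exact h (h1 h2 h3 ▸ h4)
  have h' : brianchon (Fin.snoc (Fin.snoc p a : Fin 5 → Pl.Point) b) =
      (({x | x ∈ line (p 0) (p 1) ∧ x ∈ line (p 2) (p 3) ∧ x ∈ line a b} :
        Finset Pl.Point).card : ℤ) := rfl
  rw [h', h]
  split_ifs <;> simp

theorem IsArc.sum_brianchon_snoc {p : Fin 4 → Pl.Point} (hp : IsArc p) :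
    (∑ a, ∑ b, if IsArc (Fin.snoc (Fin.snoc p a : Fin 5 → Pl.Point) b : Fin 6 → Pl.Point) then
      brianchon (Fin.snoc (Fin.snoc p a : Fin 5 → Pl.Point) b) else 0) =
      ((q : ℤ) - 4) * (q - 3) ^ 2 + if IsFanoQuad p then 2 else 0 := by
  obtain ⟨d, hd1, hd2⟩ := hp.exists_meet 0 1 2 3
  rw [← hp.sum_card_extendsOn hd1 hd2, ← Fintype.sum_prod_type']
  simp only [brianchon_snoc hp hd1 hd2, isArc_snoc, hp, true_and, extends_snoc, ← ite_and]
  rw [Finset.sum_boole, Finset.card_eq_sum_card_fiberwise (f := fun x => line x.1 x.2)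
    (t := ({ℓ | ℓ ∈ Pl.L ∧ d ∈ ℓ} : Finset (Set Pl.Point))), Nat.cast_sum]
  · refine Finset.sum_congr rfl fun ℓ hℓ => ?_
    simp only [Finset.mem_filter, Finset.mem_univ, true_and] at hℓ
    have h1 : ((extendsOn p ℓ).offDiag.card : ℤ) =
        (extendsOn p ℓ).card * ((extendsOn p ℓ).card - 1) := by
      rw [Finset.offDiag_card, Nat.cast_sub (Nat.le_mul_self _)]
      push_cast
      ring
    rw [← h1]
    congr 2
    ext ⟨a, b⟩
    simp only [Finset.mem_filter, Finset.mem_univ, true_and, Finset.mem_offDiag, extendsOn]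
    constructor
    · rintro ⟨⟨⟨h2, h3, h4, -⟩, -⟩, rfl⟩
      exact ⟨⟨by simp, h2⟩, ⟨by simp, h3⟩, h4.symm⟩
    · rintro ⟨⟨h2, h3⟩, ⟨h4, h5⟩, h6⟩
      obtain rfl := eq_line h6 hℓ.1 h2 h4
      refine ⟨⟨⟨h3, h5, h6.symm, fun i hb => ?_⟩, hℓ.2⟩, rfl⟩
      have h7 := eq_line h6 (line_mem (p i) a) (by simp) hb
      rw [extends_four_iff] at h3
      refine hp.notMem_of_extends hd1 hd2 hℓ.1 hℓ.2 (fun h => h3.1 (by simp [← h]))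
        (fun h => h3.2.1 (by simp [← h])) i ?_
      simp [← h7]
  · intro x hx
    simp only [Finset.coe_filter, Finset.mem_univ, true_and, Set.mem_ofPred_eq] at hx ⊢
    exact ⟨line_mem _ _, hx.2⟩

theorem nArcs_seven_eq :
    (Pl.nArcs 7 : ℤ) = ((q : ℤ) ^ 2 + q + 1) * ((q : ℤ) ^ 2 + q) * (q : ℤ) ^ 2 *
        ((q : ℤ) - 1) ^ 2 * ((q : ℤ) - 3) * ((q : ℤ) - 5) *
        ((q : ℤ) ^ 4 - 20 * q ^ 3 + 148 * (q : ℤ) ^ 2 - 468 * q + 498) -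
      30 * Fintype.card {p : Fin 4 → Pl.Point // IsFanoQuad p} := by
  have h : (∑ p : Fin 6 → Pl.Point, if IsArc p then brianchon p else 0) =
      Pl.nArcs 4 * (((q : ℤ) - 4) * (q - 3) ^ 2) +
        2 * Fintype.card {p : Fin 4 → Pl.Point // IsFanoQuad p} := by
    rw [sum_snoc, sum_snoc, nArcs_eq_sum, Fintype.card_subtype, ← Finset.sum_boole,
      Finset.sum_mul, Finset.mul_sum, ← Finset.sum_add_distrib]
    refine Finset.sum_congr rfl fun p _ => ?_
    by_cases hp : IsArc p
    · rw [hp.sum_brianchon_snoc]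
      simp [hp]
    · have : ¬ IsFanoQuad p := fun h => hp h.1
      simp [hp, isArc_snoc, this]
  rw [nArcs_seven, nArcs_six, sum_meetCount_three, h, nArcs_four]
  ring

/-- The third point of the line of the Fano plane on `ZMod 7` through two distinct points. -/
def fanoThird (i j : ZMod 7) : ZMod 7 := i + (![0, 3, 6, 1, 5, 4, 2] : ZMod 7 → ZMod 7) (j - i)

theorem fano_line_iff {i j k : ZMod 7} (hij : i ≠ j) (hik : i ≠ k) (hjk : j ≠ k) :
    (∃ a : ZMod 7, ({i, j, k} : Set (ZMod 7)) = {a, a + 1, a + 3}) ↔ k = fanoThird i j := by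
  have h : ∀ i j k : ZMod 7, i ≠ j → i ≠ k → j ≠ k →
      ((∃ a : ZMod 7, ({i, j, k} : Finset (ZMod 7)) = {a, a + 1, a + 3}) ↔
        k = fanoThird i j) := by
    decide +kernel
  rw [← h i j k hij hik hjk]
  refine exists_congr fun a => ?_
  rw [← Finset.coe_inj]
  push_cast
  rfl

theorem fanoThird_ne {i j : ZMod 7} (h : i ≠ j) : i ≠ fanoThird i j ∧ j ≠ fanoThird i j := by
  revert i j
  decide +kernel

theorem eq_of_ne_fanoThird {i j k : ZMod 7} (hij : i ≠ j) (hik : i ≠ k) (hjk : j ≠ k)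
    (hk : k ≠ fanoThird i j) (m : ZMod 7) : m = i ∨ m = j ∨ m = k ∨ m = fanoThird i j ∨
      m = fanoThird k i ∨ m = fanoThird k j ∨ m = fanoThird k (fanoThird i j) := by
  revert i j k m
  decide +kernel

/-- A labelled strong realization of the Fano plane. -/
def IsFano (p : ZMod 7 → Pl.Point) : Prop :=
  Function.Injective p ∧ ∀ i j k : ZMod 7, i ≠ j → i ≠ k → j ≠ k →
    (Pl.Collinear {p i, p j, p k} ↔ k = fanoThird i j)

theorem IsFano.mem_line {p : ZMod 7 → Pl.Point} (hp : IsFano p) {i j : ZMod 7} (h : i ≠ j) :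
    p (fanoThird i j) ∈ line (p i) (p j) := by
  obtain ⟨ℓ, hℓ, hs⟩ := (hp.2 i j _ h (fanoThird_ne h).1 (fanoThird_ne h).2).2 rfl
  rw [← eq_line (hp.1.ne h) hℓ (hs (by simp)) (hs (by simp))]
  exact hs (by simp)

theorem IsFano.isFanoQuad {p : ZMod 7 → Pl.Point} (hp : IsFano p) :
    IsFanoQuad ![p 2, p 4, p 5, p 6] := by
  have hinj : Function.Injective (![2, 4, 5, 6] : Fin 4 → ZMod 7) := by decide
  have hf : ∀ i j k : Fin 4, i ≠ j → i ≠ k → j ≠ k → (![2, 4, 5, 6] : Fin 4 → ZMod 7) k ≠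
      fanoThird ((![2, 4, 5, 6] : Fin 4 → ZMod 7) i) ((![2, 4, 5, 6] : Fin 4 → ZMod 7) j) := by
    decide +kernel
  have hcomp : ![p 2, p 4, p 5, p 6] = p ∘ ![2, 4, 5, 6] := by
    ext i; fin_cases i <;> rfl
  refine ⟨?_, p 1, p 3, p 0, hp.mem_line (i := 2) (j := 4) (by decide),
    hp.mem_line (i := 5) (j := 6) (by decide), hp.mem_line (i := 2) (j := 5) (by decide),
    hp.mem_line (i := 4) (j := 6) (by decide), hp.mem_line (i := 2) (j := 6) (by decide),
    hp.mem_line (i := 4) (j := 5) (by decide),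
    (hp.2 1 3 0 (by decide) (by decide) (by decide)).2 (by decide)⟩
  rw [hcomp]
  refine ⟨hp.1.comp hinj, fun i j k hij hik hjk h => ?_⟩
  exact hf i j k hij hik hjk ((hp.2 _ _ _ (hinj.ne hij) (hinj.ne hik) (hinj.ne hjk)).1 h)

theorem IsFano.ext {p p' : ZMod 7 → Pl.Point} (hp : IsFano p) (hp' : IsFano p')
    (h2 : p 2 = p' 2) (h4 : p 4 = p' 4) (h5 : p 5 = p' 5) (h6 : p 6 = p' 6) : p = p' := by
  have ha := hp.isFanoQuad.1
  have h1 : p 1 = p' 1 := point_unique (line_mem _ _) (line_mem _ _) (ha.line_ne 0 1 2 3)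
    (hp.mem_line (i := 2) (j := 4) (by decide)) (hp.mem_line (i := 5) (j := 6) (by decide))
    (by have h := hp'.mem_line (i := 2) (j := 4) (by decide)
        rw [← h2, ← h4] at h
        exact h)
    (by have h := hp'.mem_line (i := 5) (j := 6) (by decide)
        rw [← h5, ← h6] at h
        exact h)
  have h3 : p 3 = p' 3 := point_unique (line_mem _ _) (line_mem _ _) (ha.line_ne 0 2 1 3)
    (hp.mem_line (i := 2) (j := 5) (by decide)) (hp.mem_line (i := 4) (j := 6) (by decide))
    (by have h := hp'.mem_line (i := 2) (j := 5) (by decide)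
        rw [← h2, ← h5] at h
        exact h)
    (by have h := hp'.mem_line (i := 4) (j := 6) (by decide)
        rw [← h4, ← h6] at h
        exact h)
  have h0 : p 0 = p' 0 := point_unique (line_mem _ _) (line_mem _ _) (ha.line_ne 0 3 1 2)
    (hp.mem_line (i := 2) (j := 6) (by decide)) (hp.mem_line (i := 4) (j := 5) (by decide))
    (by have h := hp'.mem_line (i := 2) (j := 6) (by decide)
        rw [← h2, ← h6] at h
        exact h)
    (by have h := hp'.mem_line (i := 4) (j := 5) (by decide)
        rw [← h4, ← h5] at h
        exact h)
  ext i
  fin_cases i <;> assumption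

theorem IsFanoQuad.exists_isFano {r : Fin 4 → Pl.Point} (hr : IsFanoQuad r) :
    ∃ p : ZMod 7 → Pl.Point, IsFano p ∧ ![p 2, p 4, p 5, p 6] = r := by
  obtain ⟨hr, x, y, z, hx1, hx2, hy1, hy2, hz1, hz2, hcol⟩ := hr
  have hx : ∀ i, x ≠ r i := fun i => by
    fin_cases i
    exacts [hr.ne_meet hx1 hx2 0, hr.ne_meet hx1 hx2 1, hr.ne_meet hx1 hx2 2, hr.ne_meet hx1 hx2 3]
  have hy : ∀ i, y ≠ r i := fun i => by
    fin_cases i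
    exacts [hr.ne_meet hy1 hy2 0, hr.ne_meet hy1 hy2 1, hr.ne_meet hy1 hy2 2, hr.ne_meet hy1 hy2 3]
  have hz : ∀ i, z ≠ r i := fun i => by
    fin_cases i
    exacts [hr.ne_meet hz1 hz2 0, hr.ne_meet hz1 hz2 1, hr.ne_meet hz1 hz2 2, hr.ne_meet hz1 hz2 3]
  have hxy : x ≠ y := by
    rintro rfl
    exact hx 0 (point_unique (line_mem _ _) (line_mem _ _) (hr.line_ne 0 1 0 2) hx1 hy1
      (by simp) (by simp))
  have hxz : x ≠ z := by
    rintro rfl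
    exact hx 0 (point_unique (line_mem _ _) (line_mem _ _) (hr.line_ne 0 1 0 3) hx1 hz1
      (by simp) (by simp))
  have hyz : y ≠ z := by
    rintro rfl
    exact hy 0 (point_unique (line_mem _ _) (line_mem _ _) (hr.line_ne 0 2 0 3) hy1 hz1
      (by simp) (by simp))
  let p : ZMod 7 → Pl.Point := (![z, x, r 0, y, r 1, r 2, r 3] : Fin 7 → Pl.Point)
  have hinj : Function.Injective p := by
    have := hr.1.ne (a₁ := 0) (a₂ := 1) (by decide)
    have := hr.1.ne (a₁ := 0) (a₂ := 2) (by decide)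
    have := hr.1.ne (a₁ := 0) (a₂ := 3) (by decide)
    have := hr.1.ne (a₁ := 1) (a₂ := 2) (by decide)
    have := hr.1.ne (a₁ := 1) (a₂ := 3) (by decide)
    have := hr.1.ne (a₁ := 2) (a₂ := 3) (by decide)
    have h : Function.Injective (![z, x, r 0, y, r 1, r 2, r 3] : Fin 7 → Pl.Point) := by
      rw [← List.nodup_ofFn]
      simp [*, Ne.symm]
    exact h
  have hline : ∀ a, ∃ ℓ ∈ Pl.L, p a ∈ ℓ ∧ p (a + 1) ∈ ℓ ∧ p (a + 3) ∈ ℓ := by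
    obtain ⟨ℓ, hℓ, hsub⟩ := hcol
    intro a
    fin_cases a
    · exact ⟨ℓ, hℓ, hsub (Or.inr (Or.inr rfl)), hsub (Or.inl rfl), hsub (Or.inr (Or.inl rfl))⟩
    · exact ⟨_, line_mem _ _, hx1, left_mem_line _ _, right_mem_line _ _⟩
    · exact ⟨_, line_mem _ _, left_mem_line _ _, hy1, right_mem_line _ _⟩
    · exact ⟨_, line_mem _ _, hy2, left_mem_line _ _, right_mem_line _ _⟩
    · exact ⟨_, line_mem _ _, left_mem_line _ _, right_mem_line _ _, hz2⟩
    · exact ⟨_, line_mem _ _, left_mem_line _ _, right_mem_line _ _, hx2⟩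
    · exact ⟨_, line_mem _ _, right_mem_line _ _, hz1, left_mem_line _ _⟩
  have hcol : ∀ i j k, i ≠ j → i ≠ k → j ≠ k → k = fanoThird i j →
      Pl.Collinear {p i, p j, p k} := by
    intro i j k hij hik hjk h
    obtain ⟨a, ha⟩ := (fano_line_iff hij hik hjk).2 h
    obtain ⟨ℓ, hℓ, h1, h2, h3⟩ := hline a
    refine ⟨ℓ, hℓ, ?_⟩
    have h4 : ({p i, p j, p k} : Set Pl.Point) = {p a, p (a + 1), p (a + 3)} := by
      simpa [Set.image_insert_eq] using congrArg (p '' ·) ha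
    rw [h4]
    rintro _ (rfl | rfl | rfl) <;> assumption
  refine ⟨p, ⟨hinj, fun i j k hij hik hjk => ⟨?_, hcol i j k hij hik hjk⟩⟩, ?_⟩
  · rintro ⟨ℓ, hℓ, hs⟩
    by_contra hk
    have hi : p i ∈ ℓ := hs (by simp)
    have hj : p j ∈ ℓ := hs (by simp)
    have hk' : p k ∈ ℓ := hs (by simp)
    have hcl : ∀ m n, m ≠ n → p m ∈ ℓ → p n ∈ ℓ → p (fanoThird m n) ∈ ℓ := by
      intro m n hmn hm hn
      obtain ⟨ℓ', hℓ', hs'⟩ := hcol m n _ hmn (fanoThird_ne hmn).1 (fanoThird_ne hmn).2 rfl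
      rw [line_unique (hinj.ne hmn) hℓ hℓ' hm hn (hs' (by simp)) (hs' (by simp))]
      exact hs' (by simp)
    have hall : ∀ m, p m ∈ ℓ := by
      intro m
      rcases eq_of_ne_fanoThird hij hik hjk hk m with h | h | h | h | h | h | h <;> rw [h]
      · exact hi
      · exact hj
      · exact hk'
      · exact hcl _ _ hij hi hj
      · exact hcl _ _ hik.symm hk' hi
      · exact hcl _ _ hjk.symm hk' hj
      · exact hcl _ _ hk hk' (hcl _ _ hij hi hj)
    refine hr.2 0 1 2 (by decide) (by decide) (by decide) ⟨ℓ, hℓ, ?_⟩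
    rintro _ (rfl | rfl | rfl)
    exacts [hall 2, hall 4, hall 5]
  · ext i
    fin_cases i <;> rfl

theorem card_isFano :
    Fintype.card {p : ZMod 7 → Pl.Point // IsFano p} =
      Fintype.card {p : Fin 4 → Pl.Point // IsFanoQuad p} := by
  refine Fintype.card_of_bijective (f := fun p => ⟨_, p.2.isFanoQuad⟩) ⟨?_, ?_⟩
  · rintro ⟨p, hp⟩ ⟨p', hp'⟩ h
    have h := congrArg Subtype.val h
    exact Subtype.ext (hp.ext hp' (congrFun h 0) (congrFun h 1) (congrFun h 2) (congrFun h 3))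
  · rintro ⟨r, hr⟩
    obtain ⟨p, hp, h⟩ := hr.exists_isFano
    exact ⟨⟨p, hp⟩, Subtype.ext h⟩

/-- The map of the Fano plane sending the frame `0, 1, 2` to `a, b, c`. -/
def fanoMap (a b c : ZMod 7) : ZMod 7 → ZMod 7 :=
  (![a, b, c, fanoThird a b, fanoThird b c, fanoThird c (fanoThird a b), fanoThird a c] :
    Fin 7 → ZMod 7)

theorem fanoMap_injective : ∀ a b c : ZMod 7, a ≠ b → a ≠ c → b ≠ c → c ≠ fanoThird a b →
    ∀ i j, fanoMap a b c i = fanoMap a b c j → i = j := by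
  decide +kernel

set_option synthInstance.maxSize 1000 in
theorem fanoMap_fanoThird : ∀ a b c : ZMod 7, a ≠ b → a ≠ c → b ≠ c → c ≠ fanoThird a b →
    ∀ i j, i ≠ j →
      fanoMap a b c (fanoThird i j) = fanoThird (fanoMap a b c i) (fanoMap a b c j) := by
  decide +kernel

theorem card_fano_automorphisms :
    (Finset.univ.filter fun σ : Equiv.Perm (ZMod 7) =>
      ∀ i j, i ≠ j → σ (fanoThird i j) = fanoThird (σ i) (σ j)).card = 168 := by
  have hcard : (Finset.univ.filter fun x : ZMod 7 × ZMod 7 × ZMod 7 =>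
      x.1 ≠ x.2.1 ∧ x.1 ≠ x.2.2 ∧ x.2.1 ≠ x.2.2 ∧ x.2.2 ≠ fanoThird x.1 x.2.1).card = 168 := by
    decide +kernel
  rw [← hcard]
  refine Finset.card_bij (fun σ _ => (σ 0, σ 1, σ 2)) ?_ ?_ ?_
  · intro σ hσ
    simp only [Finset.mem_filter, Finset.mem_univ, true_and] at hσ ⊢
    rw [← hσ 0 1 (by decide)]
    exact ⟨σ.injective.ne (by decide), σ.injective.ne (by decide), σ.injective.ne (by decide),
      σ.injective.ne (by decide)⟩
  · intro σ hσ τ hτ h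
    simp only [Finset.mem_filter, Finset.mem_univ, true_and, Prod.mk.injEq] at hσ hτ h
    obtain ⟨h0, h1, h2⟩ := h
    have key : ∀ i j, i ≠ j → σ i = τ i → σ j = τ j → σ (fanoThird i j) = τ (fanoThird i j) := by
      intro i j hij hi hj
      rw [hσ i j hij, hτ i j hij, hi, hj]
    have h3 : σ 3 = τ 3 := key 0 1 (by decide) h0 h1
    have h4 : σ 4 = τ 4 := key 1 2 (by decide) h1 h2
    have h5 : σ 5 = τ 5 := key 2 3 (by decide) h2 h3
    have h6 : σ 6 = τ 6 := key 0 2 (by decide) h0 h2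
    refine Equiv.ext fun i => ?_
    fin_cases i <;> assumption
  · rintro ⟨a, b, c⟩ h
    simp only [Finset.mem_filter, Finset.mem_univ, true_and] at h
    obtain ⟨f, hf, hσ, h0, h1, h2⟩ : ∃ f : ZMod 7 → ZMod 7, Function.Injective f ∧
        (∀ i j, i ≠ j → f (fanoThird i j) = fanoThird (f i) (f j)) ∧
        f 0 = a ∧ f 1 = b ∧ f 2 = c :=
      ⟨fanoMap a b c, fun i j => fanoMap_injective a b c h.1 h.2.1 h.2.2.1 h.2.2.2 i j,
        fanoMap_fanoThird a b c h.1 h.2.1 h.2.2.1 h.2.2.2, rfl, rfl, rfl⟩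
    refine ⟨Equiv.ofBijective f (Finite.injective_iff_bijective.1 hf), ?_, ?_⟩
    · simpa using hσ
    · simp [h0, h1, h2]

theorem IsFano.comp_iff {p : ZMod 7 → Pl.Point} (hp : IsFano p) (σ : Equiv.Perm (ZMod 7)) :
    IsFano (p ∘ σ) ↔ ∀ i j, i ≠ j → σ (fanoThird i j) = fanoThird (σ i) (σ j) := by
  have h1 : ∀ i j k, i ≠ j → i ≠ k → j ≠ k →
      (Pl.Collinear {p (σ i), p (σ j), p (σ k)} ↔ σ k = fanoThird (σ i) (σ j)) :=
    fun i j k hij hik hjk => hp.2 _ _ _ (σ.injective.ne hij) (σ.injective.ne hik)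
      (σ.injective.ne hjk)
  constructor
  · intro h i j hij
    have h2 := fanoThird_ne hij
    exact (h1 i j _ hij h2.1 h2.2).1 ((h.2 i j _ hij h2.1 h2.2).2 rfl)
  · intro h
    refine ⟨hp.1.comp σ.injective, fun i j k hij hik hjk => ?_⟩
    rw [Function.comp, Function.comp, Function.comp, h1 i j k hij hik hjk, ← h i j hij]
    exact σ.injective.eq_iff

theorem A7_eq : Pl.A7 = Fintype.card
    {p : ZMod 7 → Pl.Point // ∃ σ : Equiv.Perm (ZMod 7), IsFano (p ∘ σ)} := by
  rw [A7, Nat.card_eq_fintype_card]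
  refine Fintype.card_congr (Equiv.subtypeEquivRight fun p => ?_)
  rw [← exists_and_left]
  refine exists_congr fun σ => and_congr ?_ ?_
  · exact (σ.injective_comp p).symm
  · refine forall₃_congr fun i j k => ?_
    refine forall₃_congr fun hij hik hjk => ?_
    rw [fano_line_iff hij hik hjk]
    rfl

theorem A7_mul : Pl.A7 * 168 = 5040 * Fintype.card {p : ZMod 7 → Pl.Point // IsFano p} := by
  have h1 : ∀ p : ZMod 7 → Pl.Point, (∑ σ : Equiv.Perm (ZMod 7), if IsFano (p ∘ σ) then 1 else 0) =
      if ∃ σ : Equiv.Perm (ZMod 7), IsFano (p ∘ σ) then 168 else 0 := by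
    intro p
    split_ifs with h
    · obtain ⟨σ, hσ⟩ := h
      rw [← Equiv.sum_comp (Equiv.mulLeft σ), ← card_fano_automorphisms, Finset.card_filter]
      refine Finset.sum_congr rfl fun τ _ => ?_
      congr 1
      rw [← hσ.comp_iff]
      rfl
    · push Not at h
      simp [h]
  have h2 : ∀ σ : Equiv.Perm (ZMod 7), (∑ p : ZMod 7 → Pl.Point,
      if IsFano (p ∘ σ) then 1 else 0) =
        Fintype.card {p : ZMod 7 → Pl.Point // IsFano p} := by
    intro σ
    rw [Fintype.card_subtype, Finset.card_filter]
    exact Equiv.sum_comp (σ.symm.arrowCongr (Equiv.refl Pl.Point))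
      fun p => if IsFano p then 1 else 0
  rw [A7_eq, Fintype.card_subtype, Finset.card_filter, Finset.sum_mul]
  simp only [ite_mul, one_mul, zero_mul, ← h1]
  rw [Finset.sum_comm]
  simp only [h2, Finset.sum_const, Finset.card_univ, Fintype.card_perm, ZMod.card, smul_eq_mul]
  rfl

theorem A7_eq_mul : Pl.A7 = 30 * Fintype.card {p : Fin 4 → Pl.Point // IsFanoQuad p} := by
  have := A7_mul (Pl := Pl)
  rw [card_isFano] at this
  lia

end ProjPlane

/-- Glynn's formula for the number of ordered 7-arcs in any finite projective
plane of order `q`, in terms of the number `A₇` of strong realizations of the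
Fano plane. -/
theorem count_seven_arcs (q : ℕ) (Pl : ProjPlane q) :
    (Pl.nArcs 7 : ℤ) =
      ((q : ℤ) ^ 2 + q + 1) * ((q : ℤ) ^ 2 + q) * (q : ℤ) ^ 2 * ((q : ℤ) - 1) ^ 2 *
        ((q : ℤ) - 3) * ((q : ℤ) - 5) *
        ((q : ℤ) ^ 4 - 20 * q ^ 3 + 148 * (q : ℤ) ^ 2 - 468 * q + 498)
      - (Pl.A7 : ℤ) := by
  rw [ProjPlane.nArcs_seven_eq, ProjPlane.A7_eq_mul]
  push_cast
  ring
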